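/- For every n ≥ 1, the first and last entries of the list 𝒮_n, namely the paths e^n and u e^{n−1} d, differ in exactly 2 places; hence 𝒮_n is a circular Gray code with distance 5. -/

import Mathlib

/-- Steps of a Schröder path: `u = (1,1)`, `d = (1,-1)`, `e = (2,0)`. -/
inductive Step : Type
  | u : Step
  | d : Step
  | e : Step
deriving DecidableEq, Repr

/-- The large Schröder numbers: `r 0 = 1` and
`r n = r (n-1) + ∑_{k=1}^{n} r (k-1) * r (n-k)` for `n > 0`. -/
def schroder : ℕ → ℕ
  | 0 => 1
  | n + 1 =>
    schroder n + ∑ k ∈ (Finset.range (n + 1)).attach, schroder k.1 * schroder (n - k.1)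
decreasing_by
  · omega
  · have := k.2; simp only [Finset.mem_range] at this; omega
  · omega

/-- `B 1 = 0` and `B i = r_0 + ⋯ + r_{i-2}` for `i > 1`. -/
def B (i : ℕ) : ℕ := ∑ m ∈ Finset.range (i - 1), schroder m

/-- `L^i`: the list `L` if `i` is odd, `L` reversed if `i` is even. -/
def altS (L : List (List Step)) (i : ℕ) : List (List Step) :=
  if i % 2 = 1 then L else L.reverse

/-- `L(j)`: the `j`-th entry of the list `L` (entries numbered from 1). -/
def entS (L : List (List Step)) (j : ℕ) : List Step := L.getD (j - 1) []

/-- The recursively defined list `𝒮_n` of Schröder paths: `𝒮_0` consists of the empty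
path, and `𝒮_n` is the concatenation of `e⬝𝒮_{n-1}(i)` for `i = 1,…,r_{n-1}` followed by,
for `i = 1,…,n`, `j = 1,…,r_{i-1}`, `k = 1,…,r_{n-i}`, the path
`u⬝𝒮_{i-1}^{n+i}(j)⬝d⬝𝒮_{n-i}^{j+B(i)+1}(k)`. -/
def Slist : ℕ → List (List Step)
  | 0 => [[]]
  | n + 1 =>
    ((Slist n).map fun p => Step.e :: p) ++
      ((List.range (n + 1)).attach.flatMap fun i =>
        (List.range (schroder i.1)).flatMap fun j =>
          (List.range (schroder (n - i.1))).flatMap fun k =>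
            [Step.u :: entS (altS (Slist i.1) (n + 1 + (i.1 + 1))) (j + 1) ++
              Step.d :: entS (altS (Slist (n - i.1)) (j + 1 + B (i.1 + 1) + 1)) (k + 1)])
decreasing_by
  · omega
  · have := i.2; simp only [List.mem_range] at this; omega
  · omega

/-- Expand a path by replacing every level step `e = (2,0)` by two unit level steps. -/
def expand (p : List Step) : List Step :=
  p.flatMap fun s => match s with
    | Step.e => [Step.e, Step.e]
    | s => [s]

/-- `d(p₁,p₂)`: the number of places in which two Schröder paths differ when every
step `e` is replaced by two unit level steps. -/
def dpath (p q : List Step) : ℕ :=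
  (((expand p).zip (expand q)).filter fun x => x.1 != x.2).length

/-- The vertical displacement of a step. -/
def ycost : Step → ℤ
  | Step.u => 1
  | Step.d => -1
  | Step.e => 0

/-- The horizontal displacement of a step. -/
def xcost : Step → ℕ
  | Step.u => 1
  | Step.d => 1
  | Step.e => 2

/-- `p` is a Schröder path of length `n`: it goes from `(0,0)` to `(2n,0)` and never
goes below the `x`-axis. -/
def IsSchroder (n : ℕ) (p : List Step) : Prop :=
  (p.map xcost).sum = 2 * n ∧ (p.map ycost).sum = 0 ∧
    ∀ q : List Step, q <+: p → 0 ≤ (q.map ycost).sum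

/-! ### Expansion and distance -/

@[simp]
theorem expand_append (p q : List Step) : expand (p ++ q) = expand p ++ expand q := by
  simp [expand]

@[simp]
theorem dpath_self (p : List Step) : dpath p p = 0 := by
  simp [dpath, List.zip_eq_zipWith]

theorem dpath_comm (p q : List Step) : dpath p q = dpath q p := by
  have key : ∀ l m : List Step, ((l.zip m).filter fun x => x.1 != x.2).length =
      ((m.zip l).filter fun x => x.1 != x.2).length := by
    intro l
    induction l with
    | nil => simp
    | cons a l ih =>
      intro m
      cases m with
      | nil => simp
      | cons b m =>
        have h := ih m
        by_cases hab : a = b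
        · simpa [hab] using h
        · simpa [hab, Ne.symm hab] using h
  exact key _ _

theorem dpath_append {p p' : List Step} (h : (expand p).length = (expand p').length)
    (q q' : List Step) : dpath (p ++ q) (p' ++ q') = dpath p p' + dpath q q' := by
  simp [dpath, List.zip_append h]

/-- Two paths are close if they have the same horizontal extent and distance at most `5`. -/
def Close (p q : List Step) : Prop :=
  (expand p).length = (expand q).length ∧ dpath p q ≤ 5

theorem Close.symm {p q : List Step} (h : Close p q) : Close q p :=
  ⟨h.1.symm, dpath_comm p q ▸ h.2⟩

theorem Close.append_left (x : List Step) {p q : List Step} (h : Close p q) :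
    Close (x ++ p) (x ++ q) := by
  refine ⟨by simp [h.1], ?_⟩
  rw [dpath_append rfl, dpath_self, zero_add]
  exact h.2

theorem Close.append_right {p q : List Step} (h : Close p q) (x : List Step) :
    Close (p ++ x) (q ++ x) := by
  refine ⟨by simp [h.1], ?_⟩
  rw [dpath_append h.1, dpath_self, add_zero]
  exact h.2

/-! ### Lists with close neighbours and prescribed endpoints -/

/-- `L` starts in `a`, ends in `b`, and its consecutive entries are close. -/
structure GrayFrom (L : List (List Step)) (a b : List Step) : Prop where
  chain : L.IsChain Close
  head : L.head? = some a
  last : L.getLast? = some b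

namespace GrayFrom

variable {L M : List (List Step)} {a b c d : List Step}

theorem reverse (h : GrayFrom L a b) : GrayFrom L.reverse b a := by
  refine ⟨?_, by simpa using h.last, by simpa using h.head⟩
  rw [List.isChain_reverse]
  exact h.chain.imp fun _ _ => Close.symm

theorem map (h : GrayFrom L a b) {f : List Step → List Step}
    (hf : ∀ p q, Close p q → Close (f p) (f q)) : GrayFrom (L.map f) (f a) (f b) := by
  refine ⟨?_, by simp [h.head], by simp [h.last]⟩
  rw [List.isChain_map]
  exact h.chain.imp hf

theorem append (h : GrayFrom L a b) (h' : GrayFrom M c d) (hbc : Close b c) :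
    GrayFrom (L ++ M) a d := by
  refine ⟨?_, by simp [h.head], by simp [h'.last]⟩
  rw [List.isChain_append]
  refine ⟨h.chain, h'.chain, ?_⟩
  simpa [h.last, h'.head] using hbc

theorem flatMap_range (f : ℕ → List (List Step)) (s t : ℕ → List Step) (N : ℕ)
    (hf : ∀ i ≤ N, GrayFrom (f i) (s i) (t i)) (hc : ∀ i < N, Close (t i) (s (i + 1))) :
    GrayFrom ((List.range (N + 1)).flatMap f) (s 0) (t N) := by
  induction N with
  | zero => simpa using hf 0 le_rfl
  | succ N ih =>
    rw [List.range_succ, List.flatMap_append, List.flatMap_singleton]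
    exact (ih (fun i hi => hf i (by omega)) fun i hi => hc i (by omega)).append
      (hf _ le_rfl) (hc N (by omega))

theorem entS_one (h : GrayFrom L a b) : entS L 1 = a := by
  have := h.head
  rw [List.head?_eq_getElem?] at this
  simp [entS, List.getD_eq_getElem?_getD, this]

theorem entS_length (h : GrayFrom L a b) : entS L L.length = b := by
  have := h.last
  rw [List.getLast?_eq_getElem?] at this
  simp [entS, List.getD_eq_getElem?_getD, this]

theorem close_entS (h : GrayFrom L a b) {j : ℕ} (hj : j + 1 < L.length) :
    Close (entS L (j + 1)) (entS L (j + 2)) := by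
  have := List.isChain_iff_getElem.1 h.chain j hj
  have hj' : j < L.length := by omega
  simpa [entS, List.getD_eq_getElem?_getD, hj, hj'] using this

end GrayFrom

theorem flatMap_range_entS (L : List (List Step)) (g : List Step → List Step) :
    ((List.range L.length).flatMap fun k => [g (entS L (k + 1))]) = L.map g := by
  rw [← List.map_eq_flatMap]
  apply List.ext_getElem
  · simp
  · intro i h₁ h₂
    simp at h₂
    simp [entS, List.getD_eq_getElem?_getD, h₂]

/-! ### Recursions and counting -/

theorem schroder_succ (n : ℕ) : schroder (n + 1) =
    schroder n + ∑ k ∈ Finset.range (n + 1), schroder k * schroder (n - k) := by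
  rw [schroder, Finset.sum_attach (Finset.range (n + 1)) fun k => schroder k * schroder (n - k)]

theorem schroder_pos (n : ℕ) : 0 < schroder n := by
  induction n with
  | zero => simp [schroder]
  | succ n ih => rw [schroder_succ]; omega

theorem B_add_two (i : ℕ) : B (i + 2) = B (i + 1) + schroder i := by
  simp [B, Finset.sum_range_succ]

/-- The paths in `Slist (n + 1)` whose first return to the axis is after `2 * (i + 1)` units. -/
def returnBlock (n i j : ℕ) : List (List Step) :=
  (List.range (schroder (n - i))).flatMap fun k =>
    [Step.u :: entS (altS (Slist i) (n + 1 + (i + 1))) (j + 1) ++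
      Step.d :: entS (altS (Slist (n - i)) (j + 1 + B (i + 1) + 1)) (k + 1)]

theorem Slist_succ (n : ℕ) : Slist (n + 1) = ((Slist n).map fun p => Step.e :: p) ++
    (List.range (n + 1)).flatMap fun i => (List.range (schroder i)).flatMap (returnBlock n i) := by
  rw [Slist]
  congr 1
  rw [List.flatMap_subtype
    (g := fun i => (List.range (schroder i)).flatMap (returnBlock n i)) (hf := fun _ _ => rfl),
    List.unattach_attach]

theorem length_Slist (n : ℕ) : (Slist n).length = schroder n := by
  induction n with
  | zero => simp [Slist, schroder]
  | succ n ih =>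
    rw [Slist_succ, schroder_succ]
    simp [returnBlock, ih, List.length_flatMap, Finset.sum, Multiset.range]

@[simp]
theorem length_altS_Slist (n p : ℕ) : (altS (Slist n) p).length = schroder n := by
  unfold altS
  split <;> simp [length_Slist]

/-! ### The first and last entries -/

/-- The last path of `Slist n`. -/
def lastPath : ℕ → List Step
  | 0 => []
  | n + 1 => Step.u :: (List.replicate n Step.e ++ [Step.d])

/-- The first path of `altS (Slist n) p`. -/
def startPath (p n : ℕ) : List Step :=
  if p % 2 = 1 then List.replicate n Step.e else lastPath n

theorem GrayFrom.altS {n : ℕ} (h : GrayFrom (Slist n) (List.replicate n Step.e) (lastPath n))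
    (p : ℕ) : GrayFrom (altS (Slist n) p) (startPath p n) (startPath (p + 1) n) := by
  rcases Nat.mod_two_eq_zero_or_one p with hp | hp
  · have hp' : (p + 1) % 2 = 1 := by omega
    simpa [_root_.altS, startPath, hp, hp'] using h.reverse
  · have hp' : (p + 1) % 2 = 0 := by omega
    simpa [_root_.altS, startPath, hp, hp'] using h

theorem close_of_middle (x y : List Step) {m m' : List Step} (h : Close m m') {p q : List Step}
    (hp : p = x ++ m ++ y) (hq : q = x ++ m' ++ y) : Close p q := by
  subst hp hq
  exact (h.append_left x).append_right y

/-- Moving one unit of length from the second component to the first. -/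
theorem close_startPath (p q i m : ℕ) :
    Close (Step.u :: startPath p i ++ Step.d :: startPath q (m + 1))
      (Step.u :: startPath p (i + 1) ++ Step.d :: startPath q m) := by
  have he : ∀ k, List.replicate (k + 1) Step.e = List.replicate k Step.e ++ [Step.e] :=
    fun k => List.replicate_succ'
  unfold startPath
  split <;> split
  · exact close_of_middle (Step.u :: List.replicate i Step.e) (List.replicate m Step.e)
      (m := [.d, .e]) (m' := [.e, .d]) (by unfold Close; decide)
      (by simp [List.replicate_succ]) (by simp [he])
  · cases m with
    | zero =>
      exact close_of_middle (Step.u :: List.replicate i Step.e) []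
        (m := [.d, .u, .d]) (m' := [.e, .d]) (by unfold Close; decide)
        (by simp [lastPath]) (by simp [lastPath, he])
    | succ m =>
      exact close_of_middle (Step.u :: List.replicate i Step.e)
        (List.replicate m Step.e ++ [Step.d])
        (m := [.d, .u, .e]) (m' := [.e, .d, .u]) (by unfold Close; decide)
        (by simp [lastPath, List.replicate_succ]) (by simp [lastPath, he])
  · cases i with
    | zero =>
      exact close_of_middle [Step.u] (List.replicate m Step.e)
        (m := [.d, .e]) (m' := [.u, .d, .d]) (by unfold Close; decide)
        (by simp [lastPath, List.replicate_succ]) (by simp [lastPath])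
    | succ i =>
      exact close_of_middle (Step.u :: Step.u :: List.replicate i Step.e) (List.replicate m Step.e)
        (m := [.d, .d, .e]) (m' := [.e, .d, .d]) (by unfold Close; decide)
        (by simp [lastPath, List.replicate_succ]) (by simp [lastPath, he])
  · cases i with
    | zero =>
      cases m with
      | zero => simp only [lastPath]; unfold Close; decide
      | succ m =>
        exact close_of_middle [Step.u] (List.replicate m Step.e ++ [Step.d])
          (m := [.d, .u, .e]) (m' := [.u, .d, .d, .u]) (by unfold Close; decide)
          (by simp [lastPath, List.replicate_succ]) (by simp [lastPath])
    | succ i =>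
      cases m with
      | zero =>
        exact close_of_middle (Step.u :: Step.u :: List.replicate i Step.e) []
          (m := [.d, .d, .u, .d]) (m' := [.e, .d, .d]) (by unfold Close; decide)
          (by simp [lastPath]) (by simp [lastPath, he])
      | succ m =>
        exact close_of_middle (Step.u :: Step.u :: List.replicate i Step.e)
          (List.replicate m Step.e ++ [Step.d])
          (m := [.d, .d, .u, .e]) (m' := [.e, .d, .d, .u]) (by unfold Close; decide)
          (by simp [lastPath, List.replicate_succ]) (by simp [lastPath, he])

theorem close_cons_lastPath (n : ℕ) :
    Close (Step.e :: lastPath n) (Step.u :: Step.d :: lastPath n) :=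
  close_of_middle [] (lastPath n) (m := [.e]) (m' := [.u, .d]) (by unfold Close; decide)
    (by simp) (by simp)

/-! ### The Gray code property -/

theorem grayFrom_returnBlock {n i : ℕ}
    (h : GrayFrom (Slist (n - i)) (List.replicate (n - i) Step.e) (lastPath (n - i))) (j : ℕ) :
    GrayFrom (returnBlock n i j)
      (Step.u :: entS (altS (Slist i) (n + i)) (j + 1) ++
        Step.d :: startPath (j + B (i + 1)) (n - i))
      (Step.u :: entS (altS (Slist i) (n + i)) (j + 1) ++
        Step.d :: startPath (j + B (i + 1) + 1) (n - i)) := by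
  have hn : altS (Slist i) (n + 1 + (i + 1)) = altS (Slist i) (n + i) := by
    simp only [altS, show (n + 1 + (i + 1)) % 2 = (n + i) % 2 by omega]
  have hp : altS (Slist (n - i)) (j + 1 + B (i + 1) + 1) =
      altS (Slist (n - i)) (j + B (i + 1)) := by
    simp only [altS, show (j + 1 + B (i + 1) + 1) % 2 = (j + B (i + 1)) % 2 by omega]
  have hb := flatMap_range_entS (altS (Slist (n - i)) (j + B (i + 1))) fun C =>
    Step.u :: entS (altS (Slist i) (n + i)) (j + 1) ++ Step.d :: C
  rw [length_altS_Slist] at hb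
  rw [returnBlock, hn, hp, hb]
  refine (h.altS _).map fun p q hpq => ?_
  simpa using hpq.append_left (Step.u :: entS (altS (Slist i) (n + i)) (j + 1) ++ [Step.d])

theorem grayFrom_flatMap_returnBlock {n i : ℕ}
    (h : GrayFrom (Slist (n - i)) (List.replicate (n - i) Step.e) (lastPath (n - i)))
    (h' : GrayFrom (Slist i) (List.replicate i Step.e) (lastPath i)) :
    GrayFrom ((List.range (schroder i)).flatMap (returnBlock n i))
      (Step.u :: startPath (n + i) i ++ Step.d :: startPath (B (i + 1)) (n - i))
      (Step.u :: startPath (n + i + 1) i ++ Step.d :: startPath (B (i + 2)) (n - i)) := by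
  obtain ⟨N, hN⟩ := Nat.exists_eq_add_one_of_ne_zero (schroder_pos i).ne'
  have hA := h'.altS (n + i)
  have hl : (altS (Slist i) (n + i)).length = N + 1 := by simp [hN]
  have key := GrayFrom.flatMap_range (returnBlock n i) _ _ N
    (fun j _ => grayFrom_returnBlock h j) (by
      intro j hj
      have := ((hA.close_entS (j := j) (by omega)).append_left [Step.u]).append_right
        (Step.d :: startPath (j + B (i + 1) + 1) (n - i))
      rw [show j + 1 + B (i + 1) = j + B (i + 1) + 1 by omega]
      simpa using this)
  have hlast := hA.entS_length
  rw [hl] at hlast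
  rw [hlast, zero_add, zero_add, hA.entS_one,
    show N + B (i + 1) + 1 = B (i + 2) by rw [B_add_two, hN]; omega] at key
  rwa [hN]

theorem grayFrom_Slist (n : ℕ) :
    GrayFrom (Slist n) (List.replicate n Step.e) (lastPath n) := by
  induction n using Nat.strong_induction_on with
  | _ n ih =>
    cases n with
    | zero => rw [Slist]; exact ⟨by simp, rfl, rfl⟩
    | succ n =>
      have key := GrayFrom.flatMap_range
        (fun i => (List.range (schroder i)).flatMap (returnBlock n i)) _ _ n
        (fun i hi => grayFrom_flatMap_returnBlock (ih (n - i) (by omega)) (ih i (by omega))) (by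
          intro i hi
          obtain ⟨m, hm⟩ : ∃ m, n - i = m + 1 := ⟨n - i - 1, by omega⟩
          rw [hm, show n - (i + 1) = m by omega]
          exact close_startPath _ _ _ _)
      have h₁ : startPath (n + 0) 0 = [] := by simp [startPath, lastPath]
      have h₂ : startPath (B (0 + 1)) (n - 0) = lastPath n := by simp [startPath, B]
      have h₃ : startPath (n + n + 1) n = List.replicate n Step.e := by
        simp [startPath, show (n + n + 1) % 2 = 1 by omega]
      have h₄ : startPath (B (n + 2)) (n - n) = [] := by simp [startPath, lastPath]
      rw [h₁, h₂, h₃, h₄] at key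
      rw [Slist_succ]
      refine GrayFrom.append
        ((ih n (by omega)).map fun p q hpq => hpq.append_left [Step.e]) key ?_
      exact close_cons_lastPath n

theorem dpath_replicate_lastPath (n : ℕ) :
    dpath (List.replicate (n + 1) Step.e) (lastPath (n + 1)) = 2 := by
  have hexp : ∀ k, expand (List.replicate k Step.e) = List.replicate (2 * k) Step.e := by
    intro k
    induction k with
    | zero => rfl
    | succ k ih =>
      rw [List.replicate_succ, ← List.singleton_append, expand_append, ih, mul_add,
        add_comm (2 * k), List.replicate_add]
      rfl
  have h₁ : expand (List.replicate (n + 1) Step.e) =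
      [Step.e] ++ List.replicate (2 * n) Step.e ++ [Step.e] := by
    rw [hexp, show 2 * (n + 1) = 1 + 2 * n + 1 by ring, List.replicate_add, List.replicate_add]
    rfl
  have h₂ : expand (lastPath (n + 1)) =
      [Step.u] ++ List.replicate (2 * n) Step.e ++ [Step.d] := by
    rw [lastPath, ← List.singleton_append, expand_append, expand_append, hexp, List.append_assoc]
    rfl
  rw [dpath, h₁, h₂, List.zip_append (by simp), List.zip_append (by simp)]
  simp

/-- The first and last entries of `𝒮_n` — the paths `e^n` and `u e^{n-1} d` — differ in
exactly 2 places; hence (together with the distance-5 property between consecutive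
entries) the list `𝒮_n` is a circular Gray code with distance 5. -/
theorem Slist_circular_gray_code :
    ∀ n : ℕ, 1 ≤ n →
      entS (Slist n) 1 = List.replicate n Step.e ∧
      entS (Slist n) (schroder n) = Step.u :: (List.replicate (n - 1) Step.e ++ [Step.d]) ∧
      dpath (entS (Slist n) 1) (entS (Slist n) (schroder n)) = 2 ∧
      ∀ q : ℕ, 1 ≤ q → q < schroder n →
        dpath (entS (Slist n) q) (entS (Slist n) (q + 1)) ≤ 5 := by
  intro n hn
  obtain ⟨n, rfl⟩ := Nat.exists_eq_add_of_le' hn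
  have h := grayFrom_Slist (n + 1)
  have hlast := h.entS_length
  rw [length_Slist] at hlast
  rw [h.entS_one, hlast]
  refine ⟨rfl, rfl, dpath_replicate_lastPath n, fun q hq hqn => ?_⟩
  obtain ⟨q, rfl⟩ := Nat.exists_eq_add_of_le' hq
  exact (h.close_entS (by rwa [length_Slist])).2
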